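/- Let A and B be n×n symmetric integer matrices. Then A and B are cospectral, i.e. have the same characteristic polynomial, if and only if for every k with 1 ≤ k ≤ n the ideals of ℚ[x] generated by the k-minors of xI_n − A and of xI_n − B coincide. -/

import Mathlib

/-- The `k`-th determinantal ideal of a matrix `M`: the ideal generated by all
`k`-minors of `M`. -/
def detIdeal {R : Type*} [CommRing R] {n m : ℕ} (M : Matrix (Fin n) (Fin m) R)
    (k : ℕ) : Ideal R :=
  Ideal.span { d : R | ∃ (r : Fin k → Fin n) (c : Fin k → Fin m),
    Function.Injective r ∧ Function.Injective c ∧ d = (M.submatrix r c).det }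

open Polynomial

section DetIdeal

variable {R S : Type*} [CommRing R] [CommRing S] {n m k : ℕ}

theorem det_submatrix_mem_detIdeal (M : Matrix (Fin n) (Fin m) R) (r : Fin k → Fin n)
    (c : Fin k → Fin m) : (M.submatrix r c).det ∈ detIdeal M k := by
  by_cases hr : Function.Injective r
  · by_cases hc : Function.Injective c
    · exact Ideal.subset_span ⟨r, c, hr, hc, rfl⟩
    · obtain ⟨i, j, hij, hne⟩ := Function.not_injective_iff.mp hc
      rw [Matrix.det_zero_of_column_eq hne fun l => by simp [hij]]
      exact zero_mem _
  · obtain ⟨i, j, hij, hne⟩ := Function.not_injective_iff.mp hr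
    rw [Matrix.det_zero_of_row_eq hne (by ext l; simp [hij])]
    exact zero_mem _

theorem detIdeal_transpose_le (M : Matrix (Fin n) (Fin m) R) :
    detIdeal M.transpose k ≤ detIdeal M k := by
  refine Ideal.span_le.mpr ?_
  rintro _ ⟨r, c, -, -, rfl⟩
  rw [← Matrix.transpose_submatrix, Matrix.det_transpose]
  exact det_submatrix_mem_detIdeal M c r

theorem detIdeal_transpose (M : Matrix (Fin n) (Fin m) R) :
    detIdeal M.transpose k = detIdeal M k :=
  le_antisymm (detIdeal_transpose_le M) (detIdeal_transpose_le M.transpose)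

theorem detIdeal_mul_le_right {l : ℕ} (P : Matrix (Fin l) (Fin n) R)
    (M : Matrix (Fin n) (Fin m) R) : detIdeal (P * M) k ≤ detIdeal M k := by
  refine Ideal.span_le.mpr ?_
  rintro _ ⟨r, c, -, -, rfl⟩
  have hrows : (P * M).submatrix r c =
      fun i => ∑ j, P (r i) j • (fun t => M j (c t)) := by
    ext i t
    simp [Matrix.mul_apply]
  rw [hrows, SetLike.mem_coe]
  change Matrix.detRowAlternating.toMultilinearMap _ ∈ _
  rw [MultilinearMap.map_sum]
  refine sum_mem fun f _ => ?_
  rw [MultilinearMap.map_smul_univ]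
  exact Ideal.mul_mem_left _ _ (det_submatrix_mem_detIdeal M f c)

theorem detIdeal_mul_le_left {l : ℕ} (M : Matrix (Fin n) (Fin m) R)
    (Q : Matrix (Fin m) (Fin l) R) : detIdeal (M * Q) k ≤ detIdeal M k := by
  rw [← detIdeal_transpose, Matrix.transpose_mul, ← detIdeal_transpose M]
  exact detIdeal_mul_le_right _ _

theorem map_detIdeal (f : R →+* S) (M : Matrix (Fin n) (Fin m) R) :
    (detIdeal M k).map f = detIdeal (M.map f) k := by
  rw [detIdeal, Ideal.map_span, detIdeal]
  congr 1
  ext d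
  constructor
  · rintro ⟨_, ⟨r, c, hr, hc, rfl⟩, rfl⟩
    exact ⟨r, c, hr, hc, RingHom.map_det f _⟩
  · rintro ⟨r, c, hr, hc, rfl⟩
    exact ⟨_, ⟨r, c, hr, hc, rfl⟩, RingHom.map_det f _⟩

theorem detIdeal_self (M : Matrix (Fin n) (Fin n) R) :
    detIdeal M n = Ideal.span {M.det} := by
  refine le_antisymm (Ideal.span_le.mpr ?_) ?_
  · rintro _ ⟨r, c, hr, hc, rfl⟩
    let e := Equiv.ofBijective r (Finite.injective_iff_bijective.mp hr)
    let e' := Equiv.ofBijective c (Finite.injective_iff_bijective.mp hc)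
    have h : M.submatrix r c = (M.submatrix e id).submatrix id e' := rfl
    rw [h, Matrix.det_permute', Matrix.det_permute]
    exact Ideal.mul_mem_left _ _ (Ideal.mul_mem_left _ _ (Ideal.mem_span_singleton_self _))
  · rw [Ideal.span_singleton_le_iff_mem]
    simpa using det_submatrix_mem_detIdeal M id id

theorem charmatrix_mul_mul (P B Q : Matrix (Fin n) (Fin n) R) (h : P * Q = 1) :
    (P * B * Q).charmatrix = P.map C * B.charmatrix * Q.map C := by
  have h' : P.map (C : R →+* R[X]) * Q.map C = 1 := by
    rw [← Matrix.map_mul, h, Matrix.map_one _ C_0 C_1]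
  simp only [Matrix.charmatrix, mul_sub, sub_mul, RingHom.mapMatrix_apply, Matrix.map_mul]
  rw [← (Matrix.scalar_commute X (fun _ => Commute.all _ _) (P.map C)).eq, mul_assoc (Matrix.scalar _ _), h',
    mul_one, mul_assoc]

theorem detIdeal_charmatrix_le (P B Q : Matrix (Fin n) (Fin n) R) (h : P * Q = 1) :
    detIdeal (P * B * Q).charmatrix k ≤ detIdeal B.charmatrix k := by
  rw [charmatrix_mul_mul P B Q h]
  exact (detIdeal_mul_le_left _ _).trans (detIdeal_mul_le_right _ _)

theorem map_detIdeal_charmatrix (f : R →+* S) (A : Matrix (Fin n) (Fin n) R) :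
    (detIdeal A.charmatrix k).map (mapRingHom f) = detIdeal (A.map f).charmatrix k := by
  rw [map_detIdeal, Matrix.charmatrix_map]
  rfl

end DetIdeal

theorem Matrix.IsHermitian.detIdeal_charmatrix_le_of_charpoly_eq {n k : ℕ}
    {A B : Matrix (Fin n) (Fin n) ℝ} (hA : A.IsHermitian) (hB : B.IsHermitian)
    (h : A.charpoly = B.charpoly) :
    detIdeal A.charmatrix k ≤ detIdeal B.charmatrix k := by
  have hev := (hA.eigenvalues_eq_eigenvalues_iff hB).mpr h
  have hAs := hA.spectral_theorem
  have hBs := hB.conjStarAlgAut_star_eigenvectorUnitary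
  rw [← hev] at hBs
  rw [← hBs, Unitary.conjStarAlgAut_apply, Unitary.conjStarAlgAut_apply] at hAs
  set U := hA.eigenvectorUnitary
  set W := hB.eigenvectorUnitary
  have hone : ((U : Matrix (Fin n) (Fin n) ℝ) * star (W : Matrix (Fin n) (Fin n) ℝ)) *
      ((W : Matrix (Fin n) (Fin n) ℝ) * star (U : Matrix (Fin n) (Fin n) ℝ)) = 1 := by
    rw [mul_assoc, ← mul_assoc (star (W : Matrix (Fin n) (Fin n) ℝ)),
      Unitary.coe_star_mul_self, one_mul, ← Unitary.coe_star, Unitary.coe_mul_star_self]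
  have key := detIdeal_charmatrix_le (k := k) _ B _ hone
  convert key using 3
  simpa [mul_assoc] using hAs

theorem Polynomial.ideal_le_of_map_le {K L : Type*} [Field K] [Field L] (f : K →+* L)
    {I J : Ideal K[X]} (h : I.map (mapRingHom f) ≤ J.map (mapRingHom f)) : I ≤ J := by
  rw [← Ideal.span_singleton_generator I, ← Ideal.span_singleton_generator J] at h ⊢
  simp only [Ideal.map_span, Set.image_singleton, Ideal.span_singleton_le_span_singleton,
    coe_mapRingHom] at h ⊢
  exact (map_dvd_map' f).mp h

theorem detIdeal_charmatrix_le_of_charpoly_eq {n k : ℕ} {A B : Matrix (Fin n) (Fin n) ℚ}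
    (hA : A.IsSymm) (hB : B.IsSymm) (h : A.charpoly = B.charpoly) :
    detIdeal A.charmatrix k ≤ detIdeal B.charmatrix k := by
  refine ideal_le_of_map_le (algebraMap ℚ ℝ) ?_
  rw [map_detIdeal_charmatrix, map_detIdeal_charmatrix]
  refine Matrix.IsHermitian.detIdeal_charmatrix_le_of_charpoly_eq
    (Matrix.isHermitian_iff_isSymm.mpr (hA.map _)) (Matrix.isHermitian_iff_isSymm.mpr (hB.map _)) ?_
  rw [Matrix.charpoly_map, Matrix.charpoly_map, h]

/-- Two symmetric integer matrices are cospectral (same characteristic polynomial) if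
and only if for every `1 ≤ k ≤ n` the ideals of `ℚ[x]` generated by the `k`-minors of
`xI − A` and `xI − B` coincide. -/
theorem cospectral_iff_codeterminantal_rat {n : ℕ} (A B : Matrix (Fin n) (Fin n) ℤ)
    (hA : A.IsSymm) (hB : B.IsSymm) :
    A.charpoly = B.charpoly ↔
      (∀ k : ℕ, 1 ≤ k → k ≤ n →
        detIdeal (A.map (Int.cast : ℤ → ℚ)).charmatrix k
          = detIdeal (B.map (Int.cast : ℤ → ℚ)).charmatrix k) := by
  have hmap (M : Matrix (Fin n) (Fin n) ℤ) :
      (M.map (Int.cast : ℤ → ℚ)).charpoly = M.charpoly.map (Int.castRingHom ℚ) :=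
    M.charpoly_map (Int.castRingHom ℚ)
  constructor
  · intro h k _ _
    have h' : (A.map (Int.cast : ℤ → ℚ)).charpoly = (B.map (Int.cast : ℤ → ℚ)).charpoly := by
      rw [hmap, hmap, h]
    exact le_antisymm (detIdeal_charmatrix_le_of_charpoly_eq (hA.map _) (hB.map _) h')
      (detIdeal_charmatrix_le_of_charpoly_eq (hB.map _) (hA.map _) h'.symm)
  · intro h
    rcases Nat.eq_zero_or_pos n with rfl | hn
    · rw [Subsingleton.elim A B]
    have hspan := h n hn le_rfl
    rw [detIdeal_self, detIdeal_self, Ideal.span_singleton_eq_span_singleton] at hspan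
    have heq : (A.map (Int.cast : ℤ → ℚ)).charpoly = (B.map (Int.cast : ℤ → ℚ)).charpoly :=
      eq_of_monic_of_associated (Matrix.charpoly_monic _) (Matrix.charpoly_monic _) hspan
    rw [hmap, hmap] at heq
    exact map_injective _ Int.cast_injective heq
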